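/- (Heilbronn–Stark Lemma for arithmetic Heilbronn supercharacters) Let G be a finite group with a compatible family 𝒞 of supercharacter theories on all subgroups and integers {n(H,σ)} satisfying ACH1–ACH3. Define the arithmetic Heilbronn supercharacter of a subgroup H by Θ_H = Σ_{X∈𝒳_H} (n(H,σ_X)/σ_X(1)) · σ_X. Then for every subgroup H of G, the restriction of Θ_G to H equals Θ_H. -/

import Mathlib

open scoped BigOperators Classical

noncomputable section

/-- `χ : G → ℂ` is an irreducible character of `G`. -/
def IsIrrChar (G : Type) [Group G] (χ : G → ℂ) : Prop :=
  ∃ V : FDRep ℂ G, CategoryTheory.Simple V ∧ χ = V.character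

/-- The set of irreducible characters of `G`. -/
def Irr (G : Type) [Group G] : Set (G → ℂ) := {χ | IsIrrChar G χ}

/-- The trivial character. -/
def triv (G : Type) [Group G] : G → ℂ := fun _ => 1

/-- `σ_A = ∑_{χ ∈ A} χ(1)·χ`. -/
def sigma {G : Type} [Group G] (A : Set (G → ℂ)) : G → ℂ :=
  fun g => ∑ᶠ χ ∈ A, χ 1 * χ g

/-- The regular character `Reg(G) = ∑_{χ ∈ Irr G} χ(1)·χ`. -/
def Reg (G : Type) [Group G] : G → ℂ := fun g => ∑ᶠ χ ∈ Irr G, χ 1 * χ g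

/-- `P` is a partition of the set `S`. -/
def IsPartitionOn {α : Type} (S : Set α) (P : Set (Set α)) : Prop :=
  (∀ A ∈ P, A.Nonempty) ∧ (∀ A ∈ P, A ⊆ S) ∧ ∀ s ∈ S, ∃! A, A ∈ P ∧ s ∈ A

/-- A supercharacter theory of a finite group `G`. -/
structure SCTheory (G : Type) [Group G] [Finite G] where
  X : Set (Set (G → ℂ))
  K : Set (Set G)
  partX : IsPartitionOn (Irr G) X
  partK : IsPartitionOn Set.univ K
  one_mem : ({1} : Set G) ∈ K
  card_eq : X.ncard = K.ncard
  const : ∀ A ∈ X, ∀ B ∈ K, ∀ x ∈ B, ∀ y ∈ B, sigma A x = sigma A y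

/-- The superclass of `g`. -/
def SCl {G : Type} [Group G] [Finite G] (C : SCTheory G) (g : G) : Set G :=
  ⋃₀ {B | B ∈ C.K ∧ g ∈ B}

/-- A superclass function: a function constant on each superclass. -/
def IsSCF {G : Type} [Group G] [Finite G] (C : SCTheory G) (f : G → ℂ) : Prop :=
  ∀ B ∈ C.K, ∀ x ∈ B, ∀ y ∈ B, f x = f y

/-- A supercharacter of the theory `C`. -/
def IsSC {G : Type} [Group G] [Finite G] (C : SCTheory G) (σ : G → ℂ) : Prop :=
  ∃ A ∈ C.X, σ = sigma A

/-- Compatibility of a theory on a subgroup with a theory on the whole group. -/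
def Compat {G : Type} [Group G] [Finite G] (H : Subgroup G) (CH : SCTheory H)
    (CG : SCTheory G) : Prop :=
  ∀ h : H, (Subtype.val '' SCl CH h : Set G) ⊆ SCl CG (h : G)

/-- Compatibility of theories on nested subgroups. -/
def CompatLE {G : Type} [Group G] [Finite G] {H₁ H₂ : Subgroup G} (hle : H₁ ≤ H₂)
    (C₁ : SCTheory H₁) (C₂ : SCTheory H₂) : Prop :=
  ∀ x : H₁, (Subtype.val '' SCl C₁ x : Set G) ⊆
    Subtype.val '' SCl C₂ ⟨(x : G), hle x.2⟩

/-- Extension by zero of a function on a subgroup. -/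
def ext0 {G : Type} [Group G] (H : Subgroup G) (Φ : H → ℂ) : G → ℂ :=
  fun g => if hg : g ∈ H then Φ ⟨g, hg⟩ else 0

/-- Superinduction from `H` to `G`. -/
def Sind {G : Type} [Group G] [Finite G] (H : Subgroup G) (CG : SCTheory G)
    (Φ : H → ℂ) : G → ℂ :=
  fun g => ((Nat.card G : ℂ) / ((Nat.card H : ℂ) * ((SCl CG g).ncard : ℂ))) *
    ∑ᶠ x ∈ SCl CG g, ext0 H Φ x

/-- The standard inner product of functions on a finite type. -/
def iprod (α : Type) [Finite α] (f g : α → ℂ) : ℂ :=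
  (Nat.card α : ℂ)⁻¹ * ∑ᶠ x : α, f x * (starRingEnd ℂ) (g x)

/-- `f` is a linear (degree-one) character. -/
def IsLin {K : Type} [Group K] (f : K → ℂ) : Prop :=
  ∃ φ : K →* ℂˣ, f = fun k => (φ k : ℂ)

/-- `f` is a sum of linear characters. -/
def IsSumLin {K : Type} [Group K] (f : K → ℂ) : Prop :=
  f ∈ AddSubmonoid.closure {g | IsLin g}

end

open scoped ComplexOrder in
theorem Representation.character_inv_eq_conj {G V : Type*} [Group G] [Finite G]
    [AddCommGroup V] [Module ℂ V] [FiniteDimensional ℂ V] (ρ : Representation ℂ G V) (g : G) :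
    ρ.character g⁻¹ = starRingEnd ℂ (ρ.character g) := by
  have := Fintype.ofFinite G
  let b := Module.finBasis ℂ V
  let M : G → Matrix _ _ ℂ := fun g => LinearMap.toMatrix b b (ρ g)
  have hM : ∀ x y, M (x * y) = M x * M y := fun x y => by
    simp only [M, map_mul, LinearMap.toMatrix_mul]
  have htr : ∀ x, ρ.character x = (M x).trace := fun x => LinearMap.trace_eq_matrix_trace ℂ b _
  let P := ∑ x, (M x).conjTranspose * M x
  have hP : IsUnit P := by
    refine Matrix.PosDef.isUnit (K := ℂ) ?_
    have h1 : P = 1 + ∑ x ∈ Finset.univ.erase 1, (M x).conjTranspose * M x := by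
      simp only [P]
      rw [← Finset.add_sum_erase _ _ (Finset.mem_univ (1 : G))]
      simp [M, LinearMap.toMatrix_one]
    rw [h1]
    exact Matrix.PosDef.one.add_posSemidef
      (Matrix.posSemidef_sum _ fun x _ => Matrix.posSemidef_conjTranspose_mul_self _)
  have hinv : (M g).conjTranspose * P = P * M g⁻¹ := by
    simp only [P, Finset.mul_sum, Finset.sum_mul]
    rw [← Equiv.sum_comp (Equiv.mulRight g) fun x => (M x).conjTranspose * M x * M g⁻¹]
    refine Finset.sum_congr rfl fun x _ => ?_
    rw [Matrix.mul_assoc, ← hM]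
    simp [hM, Matrix.mul_assoc]
  have hdet := (Matrix.isUnit_iff_isUnit_det P).1 hP
  rw [htr, htr, starRingEnd_apply, ← Matrix.trace_conjTranspose]
  calc (M g⁻¹).trace = (P⁻¹ * (P * M g⁻¹)).trace := by
        rw [← Matrix.mul_assoc, Matrix.nonsing_inv_mul _ hdet, one_mul]
    _ = _ := by
        rw [← hinv, Matrix.trace_mul_comm, Matrix.mul_assoc, Matrix.mul_nonsing_inv _ hdet, mul_one]

theorem iprod_eq {α : Type} [Fintype α] (f g : α → ℂ) :
    iprod α f g = (Nat.card α : ℂ)⁻¹ * ∑ x, f x * starRingEnd ℂ (g x) := by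
  rw [iprod, finsum_eq_sum_of_fintype]

theorem iprod_conj {α : Type} [Finite α] (f g : α → ℂ) :
    starRingEnd ℂ (iprod α f g) = iprod α g f := by
  have := Fintype.ofFinite α
  simp [iprod_eq, mul_comm]

theorem iprod_sum_left {α ι : Type} [Finite α] (s : Finset ι) (c : ι → ℂ) (f : ι → α → ℂ)
    (g : α → ℂ) : iprod α (∑ i ∈ s, c i • f i) g = ∑ i ∈ s, c i * iprod α (f i) g := by
  have := Fintype.ofFinite α
  simp only [iprod_eq, Finset.sum_apply, Pi.smul_apply, smul_eq_mul, Finset.sum_mul,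
    Finset.mul_sum]
  rw [Finset.sum_comm]
  exact Finset.sum_congr rfl fun _ _ => Finset.sum_congr rfl fun _ _ => by ring

theorem iprod_sum_right {α ι : Type} [Finite α] (s : Finset ι) (c : ι → ℂ) (f : α → ℂ)
    (g : ι → α → ℂ) :
    iprod α f (∑ i ∈ s, c i • g i) = ∑ i ∈ s, starRingEnd ℂ (c i) * iprod α f (g i) := by
  rw [← iprod_conj, iprod_sum_left, map_sum]
  simp [iprod_conj]

theorem iprod_character_comp_character {H V W : Type} [Group H] [Finite H]
    [AddCommGroup V] [Module ℂ V] [FiniteDimensional ℂ V] [AddCommGroup W] [Module ℂ W]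
    [FiniteDimensional ℂ W] (ρ : Representation ℂ H V) (τ : Representation ℂ H W) :
    iprod H τ.character ρ.character = Module.finrank ℂ (Representation.IntertwiningMap ρ τ) := by
  have := Fintype.ofFinite H
  have : Invertible (Nat.card H : ℂ) := invertibleOfNonzero (by simp)
  rw [← Representation.card_inv_mul_sum_char_mul_char_eq_finrank, iprod_eq]
  simp [Representation.character_inv_eq_conj]

theorem iprod_irr_eq_ite {G : Type} [Group G] [Finite G] {χ ψ : G → ℂ} (hχ : χ ∈ Irr G)
    (hψ : ψ ∈ Irr G) : iprod G χ ψ = if χ = ψ then 1 else 0 := by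
  have := Fintype.ofFinite G
  have : Invertible (Nat.card G : ℂ) := invertibleOfNonzero (by simp)
  have key : ∀ V W : FDRep ℂ G, CategoryTheory.Simple V → CategoryTheory.Simple W →
      iprod G V.character W.character = if Nonempty (V ≅ W) then 1 else 0 := by
    intro V W _ _
    rw [← FDRep.char_orthonormal, iprod_eq]
    simp only [← Representation.character_inv_eq_conj W.ρ,
      show ∀ g, W.character g = Representation.character W.ρ g from fun _ => rfl]
  obtain ⟨V, hV, rfl⟩ := hχ
  obtain ⟨W, hW, rfl⟩ := hψ
  rw [key V W hV hW]
  by_cases h : Nonempty (V ≅ W)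
  · simp [h, FDRep.char_iso h.some]
  · rw [if_neg h, if_neg]
    intro he
    have h1 := key V V hV hV
    have h2 := key V W hV hW
    rw [if_pos ⟨CategoryTheory.Iso.refl V⟩] at h1
    rw [if_neg h, ← he, h1] at h2
    exact one_ne_zero h2

theorem irr_finite (G : Type) [Group G] [Finite G] : (Irr G).Finite := by
  have hli : LinearIndependent ℂ (fun χ : Irr G => (χ : G → ℂ)) := by
    rw [linearIndependent_iff']
    intro s c hc i hi
    have := iprod_sum_left s c (fun χ : Irr G => (χ : G → ℂ)) i
    rw [hc] at this
    simp only [iprod_irr_eq_ite (Subtype.prop _) i.2] at this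
    simpa [Subtype.coe_inj, hi, iprod, eq_comm] using this
  exact hli.setFinite

theorem irr_one {G : Type} [Group G] [Finite G] {χ : G → ℂ} (hχ : χ ∈ Irr G) :
    ∃ d : ℕ, 0 < d ∧ χ 1 = d := by
  have h1 := iprod_irr_eq_ite hχ hχ
  obtain ⟨V, hV, rfl⟩ := hχ
  refine ⟨_, Nat.pos_of_ne_zero fun h0 => ?_, FDRep.char_one V⟩
  have : Subsingleton V := Module.finrank_zero_iff.1 h0
  have hz : V.character = 0 := by
    ext g
    simp [FDRep.character, Subsingleton.elim (V.ρ g) 0]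
  simp [hz, iprod] at h1

theorem sigma_eq_sum {G : Type} [Group G] {A : Set (G → ℂ)} (hA : A.Finite) :
    sigma A = ∑ χ ∈ hA.toFinset, χ 1 • χ := by
  ext g
  simp [sigma, finsum_mem_eq_finite_toFinset_sum _ hA]

theorem exists_sigma_one_eq_natCast {G : Type} [Group G] [Finite G] {A : Set (G → ℂ)}
    (hA : A ⊆ Irr G) (hne : A.Nonempty) : ∃ d : ℕ, 0 < d ∧ sigma A 1 = d := by
  have hf := (irr_finite G).subset hA
  choose! d hd0 hd using fun χ hχ => irr_one (G := G) (χ := χ) hχ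
  refine ⟨∑ χ ∈ hf.toFinset, d χ * d χ, Finset.sum_pos (fun χ hχ => ?_) (by simpa), ?_⟩
  · have := hd0 χ (hA (by simpa using hχ))
    positivity
  · rw [sigma_eq_sum hf]
    push_cast
    rw [Finset.sum_apply]
    refine Finset.sum_congr rfl fun χ hχ => ?_
    simp [hd χ (hA (by simpa using hχ))]

theorem iprod_sigma_irr {G : Type} [Group G] [Finite G] {A : Set (G → ℂ)} (hA : A ⊆ Irr G)
    {ψ : G → ℂ} (hψ : ψ ∈ Irr G) : iprod G (sigma A) ψ = if ψ ∈ A then ψ 1 else 0 := by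
  have hf := (irr_finite G).subset hA
  rw [sigma_eq_sum hf, iprod_sum_left]
  rw [Finset.sum_congr rfl fun χ hχ => by
    rw [iprod_irr_eq_ite (hA (by simpa using hχ)) hψ]]
  simp

theorem iprod_sigma_comp_sigma {G : Type} [Group G] [Finite G] {H : Subgroup G}
    {A : Set (G → ℂ)} {B : Set (H → ℂ)} (hA : A ⊆ Irr G) (hB : B ⊆ Irr H) :
    ∃ m : ℕ, iprod H (sigma B) (fun h => sigma A (h : G)) = m := by
  have hfA := (irr_finite G).subset hA
  have hfB := (irr_finite H).subset hB
  have hres : (fun h : H => sigma A (h : G)) =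
      ∑ χ ∈ hfA.toFinset, χ 1 • fun h : H => χ (h : G) := by
    ext h
    simp [sigma_eq_sum hfA]
  rw [hres, sigma_eq_sum hfB, iprod_sum_right]
  simp only [iprod_sum_left]
  suffices hmem : _ ∈ (Nat.castRingHom ℂ).rangeS by
    obtain ⟨m, hm⟩ := hmem
    exact ⟨m, hm.symm⟩
  refine sum_mem fun χ hχ => mul_mem ?_ (sum_mem fun ψ hψ => mul_mem ?_ ?_)
  · obtain ⟨d, -, hd⟩ := irr_one (hA (by simpa using hχ) : χ ∈ Irr G)
    exact ⟨d, by simp [hd]⟩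
  · obtain ⟨d, -, hd⟩ := irr_one (hB (by simpa using hψ) : ψ ∈ Irr H)
    exact ⟨d, by simp [hd]⟩
  · obtain ⟨V, -, rfl⟩ : χ ∈ Irr G := hA (by simpa using hχ)
    obtain ⟨W, -, rfl⟩ : ψ ∈ Irr H := hB (by simpa using hψ)
    exact ⟨_, (iprod_character_comp_character
      (V.ρ.comp H.subtype : Representation ℂ H V) W.ρ).symm⟩

namespace SCTheory

variable {G : Type} [Group G] [Finite G] (C : SCTheory G)

theorem finite_X : C.X.Finite :=
  (irr_finite G).finite_subsets.subset fun A hA => C.partX.2.1 A hA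

theorem sCl_eq {B : Set G} (hB : B ∈ C.K) {g : G} (hg : g ∈ B) : SCl C g = B := by
  have : {B | B ∈ C.K ∧ g ∈ B} = {B} := by
    ext D
    refine ⟨fun hD => (C.partK.2.2 g trivial).unique hD ⟨hB, hg⟩, ?_⟩
    rintro rfl
    exact ⟨hB, hg⟩
  rw [SCl, this, Set.sUnion_singleton]

theorem sCl_mem_K (g : G) : SCl C g ∈ C.K := by
  obtain ⟨B, ⟨hB, hg⟩, -⟩ := C.partK.2.2 g trivial
  rwa [C.sCl_eq hB hg]

theorem mem_sCl (g : G) : g ∈ SCl C g := by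
  obtain ⟨B, ⟨hB, hg⟩, -⟩ := C.partK.2.2 g trivial
  rwa [C.sCl_eq hB hg]

theorem sCl_eq_of_mem {x g : G} (h : x ∈ SCl C g) : SCl C x = SCl C g :=
  C.sCl_eq (C.sCl_mem_K g) h

theorem mem_sCl_comm {x g : G} : x ∈ SCl C g ↔ g ∈ SCl C x :=
  ⟨fun h => C.sCl_eq_of_mem h ▸ C.mem_sCl g, fun h => C.sCl_eq_of_mem h ▸ C.mem_sCl x⟩

theorem iprod_sigma_sigma {A B : Set (G → ℂ)} (hA : A ∈ C.X) (hB : B ∈ C.X) :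
    iprod G (sigma A) (sigma B) = if A = B then sigma A 1 else 0 := by
  have hAI := C.partX.2.1 A hA
  have hBI := C.partX.2.1 B hB
  have hf := (irr_finite G).subset hBI
  rw [sigma_eq_sum hf, iprod_sum_right]
  split_ifs with h
  · subst h
    rw [sigma_eq_sum hf, Finset.sum_apply, ← sigma_eq_sum hf]
    refine Finset.sum_congr rfl fun χ hχ => ?_
    have hχA : χ ∈ A := by simpa using hχ
    obtain ⟨d, -, hd⟩ := irr_one (hAI hχA)
    rw [iprod_sigma_irr hAI (hAI hχA)]
    simp [hχA, hd]
  · refine Finset.sum_eq_zero fun χ hχ => ?_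
    have hχB : χ ∈ B := by simpa using hχ
    have hχA : χ ∉ A := fun hχA =>
      h ((C.partX.2.2 χ (hAI hχA)).unique ⟨hA, hχA⟩ ⟨hB, hχB⟩)
    rw [iprod_sigma_irr hAI (hBI hχB), if_neg hχA, mul_zero]

theorem exists_sigma_one {A : Set (G → ℂ)} (hA : A ∈ C.X) :
    ∃ d : ℕ, 0 < d ∧ sigma A 1 = d :=
  exists_sigma_one_eq_natCast (C.partX.2.1 A hA) (C.partX.1 A hA)

theorem sigma_one_ne_zero {A : Set (G → ℂ)} (hA : A ∈ C.X) : sigma A 1 ≠ 0 := by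
  obtain ⟨d, hd0, hd⟩ := C.exists_sigma_one hA
  rw [hd]
  exact_mod_cast hd0.ne'

theorem iprod_linearCombination_sigma (c : Set (G → ℂ) → ℂ) {B : Set (G → ℂ)} (hB : B ∈ C.X) :
    iprod G (∑ A ∈ C.finite_X.toFinset, c A • sigma A) (sigma B) = c B * sigma B 1 := by
  rw [iprod_sum_left, Finset.sum_eq_single B]
  · rw [C.iprod_sigma_sigma hB hB, if_pos rfl]
  · intro A hA hne
    rw [C.iprod_sigma_sigma (by simpa using hA) hB, if_neg hne, mul_zero]
  · simp [hB]

theorem isSCF_sigma {A : Set (G → ℂ)} (hA : A ∈ C.X) : IsSCF C (sigma A) := C.const A hA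

theorem eq_of_mem_sCl {C : SCTheory G} {f : G → ℂ} (hf : IsSCF C f) {x g : G}
    (h : x ∈ SCl C g) : f x = f g :=
  hf _ (C.sCl_mem_K g) x h g (C.mem_sCl g)

theorem exists_eq_sum_sigma {f : G → ℂ} (hf : IsSCF C f) :
    ∃ c : Set (G → ℂ) → ℂ, f = ∑ A ∈ C.finite_X.toFinset, c A • sigma A := by
  have := C.finite_X.fintype
  have := Fintype.ofFinite C.K
  choose r hr using fun B : C.K => C.partK.1 B B.2
  have hsum : ∀ c : C.X → ℂ, ∑ A, c A • sigma (A : Set (G → ℂ)) =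
      ∑ A ∈ C.finite_X.toFinset, (if h : A ∈ C.X then c ⟨A, h⟩ else 0) • sigma A := by
    intro c
    rw [Finset.sum_subtype (p := (· ∈ C.X)) (F := inferInstance) C.finite_X.toFinset (by simp)]
    simp
  let T : (C.X → ℂ) →ₗ[ℂ] (C.K → ℂ) :=
    (LinearMap.funLeft ℂ ℂ r) ∘ₗ Fintype.linearCombination ℂ fun A : C.X => sigma (A : Set (G → ℂ))
  have hext : ∀ f₁ f₂ : G → ℂ, IsSCF C f₁ → IsSCF C f₂ → f₁ ∘ r = f₂ ∘ r → f₁ = f₂ := by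
    intro f₁ f₂ h₁ h₂ h
    ext g
    have hg := hr ⟨_, C.sCl_mem_K g⟩
    rw [← eq_of_mem_sCl h₁ hg, ← eq_of_mem_sCl h₂ hg]
    exact congrFun h _
  have hscf : ∀ c : C.X → ℂ, IsSCF C (∑ A, c A • sigma (A : Set (G → ℂ))) := by
    intro c B hB x hx y hy
    simp only [Finset.sum_apply, Pi.smul_apply]
    exact Finset.sum_congr rfl fun A _ => by rw [C.const A A.2 B hB x hx y hy]
  have hT : ∀ c, T c = (∑ A, c A • sigma (A : Set (G → ℂ))) ∘ r := fun c => rfl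
  have hinj : Function.Injective T := by
    rw [← LinearMap.ker_eq_bot, LinearMap.ker_eq_bot']
    intro c hc
    rw [hT] at hc
    have h0 := hext _ 0 (hscf c) (fun _ _ _ _ _ _ => rfl) hc
    ext B
    have := C.iprod_linearCombination_sigma (fun A => if h : A ∈ C.X then c ⟨A, h⟩ else 0) B.2
    rw [← hsum, h0] at this
    simpa [iprod, C.sigma_one_ne_zero B.2] using this
  have hcard : Module.finrank ℂ (C.X → ℂ) = Module.finrank ℂ (C.K → ℂ) := by
    rw [Module.finrank_fintype_fun_eq_card, Module.finrank_fintype_fun_eq_card,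
      ← Nat.card_eq_fintype_card, ← Nat.card_eq_fintype_card]
    exact C.card_eq
  obtain ⟨c, hc⟩ := (LinearMap.injective_iff_surjective_of_finrank_eq_finrank hcard).1 hinj (f ∘ r)
  exact ⟨_, (hext _ _ hf (hscf c) hc.symm).trans (hsum c)⟩

theorem eq_sum_sigma {f : G → ℂ} (hf : IsSCF C f) :
    f = ∑ A ∈ C.finite_X.toFinset, (iprod G f (sigma A) / sigma A 1) • sigma A := by
  obtain ⟨c, rfl⟩ := C.exists_eq_sum_sigma hf
  refine Finset.sum_congr rfl fun A hA => ?_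
  have hA : A ∈ C.X := by simpa using hA
  rw [C.iprod_linearCombination_sigma c hA, mul_div_cancel_right₀ _ (C.sigma_one_ne_zero hA)]

theorem isSCF_sInd (H : Subgroup G) (Φ : H → ℂ) : IsSCF C (Sind H C Φ) := by
  intro B hB x hx y hy
  simp only [Sind, C.sCl_eq hB hx, C.sCl_eq hB hy]

theorem iprod_sInd (H : Subgroup G) (Φ : H → ℂ) {θ : G → ℂ} (hθ : IsSCF C θ) :
    iprod G (Sind H C Φ) θ = iprod H Φ (fun h => θ (h : G)) := by
  have := Fintype.ofFinite G
  have hG : (Nat.card G : ℂ) ≠ 0 := by simp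
  have hS : ∀ g, ((SCl C g).ncard : ℂ) ≠ 0 := fun g => by
    exact_mod_cast (Set.ncard_pos (Set.toFinite _)).2 ⟨g, C.mem_sCl g⟩ |>.ne'
  have hind : ∀ g, ∑ᶠ x ∈ SCl C g, ext0 H Φ x = ∑ x, if x ∈ SCl C g then ext0 H Φ x else 0 := by
    intro g
    rw [finsum_mem_def, finsum_eq_sum_of_fintype]
    simp [Set.indicator_apply]
  have hright : ∑ h : H, Φ h * starRingEnd ℂ (θ h) = ∑ x, ext0 H Φ x * starRingEnd ℂ (θ x) := by
    rw [← Finset.sum_subset (Finset.subset_univ (Finset.univ.filter (· ∈ H)))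
      fun x _ hx => by simp [ext0, show x ∉ H by simpa using hx]]
    rw [Finset.sum_subtype (p := (· ∈ H)) (F := inferInstance) (Finset.univ.filter (· ∈ H))
      (by simp)]
    simp [ext0]
  have hinner : ∀ x : G, ∑ g, (if x ∈ SCl C g then
      ((SCl C g).ncard : ℂ)⁻¹ * starRingEnd ℂ (θ g) else 0) = starRingEnd ℂ (θ x) := by
    intro x
    have : ∀ g, (if x ∈ SCl C g then ((SCl C g).ncard : ℂ)⁻¹ * starRingEnd ℂ (θ g) else 0) =
        if g ∈ SCl C x then ((SCl C x).ncard : ℂ)⁻¹ * starRingEnd ℂ (θ x) else 0 := by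
      intro g
      rw [C.mem_sCl_comm]
      refine if_ctx_congr Iff.rfl (fun h => ?_) fun _ => rfl
      rw [C.sCl_eq_of_mem h, eq_of_mem_sCl hθ h]
    rw [Finset.sum_congr rfl fun g _ => this g, ← Finset.sum_filter, Finset.sum_const,
      nsmul_eq_mul, ← mul_assoc, ← Set.ncard_coe_finset]
    simp [hS x]
  rw [iprod_eq, iprod_eq, hright]
  simp only [Sind, hind]
  calc _ = ∑ g, ∑ x, (Nat.card H : ℂ)⁻¹ * (ext0 H Φ x * (if x ∈ SCl C g then
      ((SCl C g).ncard : ℂ)⁻¹ * starRingEnd ℂ (θ g) else 0)) := by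
        simp only [Finset.mul_sum, Finset.sum_mul]
        refine Finset.sum_congr rfl fun g _ => Finset.sum_congr rfl fun x _ => ?_
        split_ifs
        · field_simp
        · simp
    _ = _ := by
        rw [Finset.sum_comm]
        simp only [← Finset.mul_sum, hinner]

end SCTheory

theorem map_sum_nsmul_of_additive_on {M : Type} [AddCommMonoid M] (S : AddSubmonoid M)
    (ν : M → ℤ) (hν : ∀ f g, f ∈ S → g ∈ S → ν (f + g) = ν f + ν g) {ι : Type}
    (s : Finset ι) (m : ι → ℕ) (f : ι → M) (hf : ∀ i ∈ s, f i ∈ S) :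
    ν (∑ i ∈ s, m i • f i) = ∑ i ∈ s, m i * ν (f i) := by
  have h0 : ν 0 = 0 := by simpa using hν 0 0 S.zero_mem S.zero_mem
  have hsmul : ∀ (k : ℕ) x, x ∈ S → ν (k • x) = k * ν x := by
    intro k x hx
    induction k with
    | zero => simp [h0]
    | succ k ih =>
      rw [succ_nsmul, hν _ _ (S.nsmul_mem hx k) hx, ih]
      push_cast
      ring
  induction s using Finset.induction_on with
  | empty => simpa
  | insert i s hi ih =>
    simp only [Finset.mem_insert, forall_eq_or_imp] at hf
    rw [Finset.sum_insert hi, Finset.sum_insert hi, hν _ _ (S.nsmul_mem hf.1 _)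
      (S.sum_mem fun j hj => S.nsmul_mem (hf.2 j hj) _), hsmul _ _ hf.1, ih hf.2]

theorem map_rat_combination_of_additive_on {α : Type} (S : AddSubmonoid (α → ℂ)) (ν : (α → ℂ) → ℤ)
    (hν : ∀ f g, f ∈ S → g ∈ S → ν (f + g) = ν f + ν g) {ι : Type} (s : Finset ι)
    (m k : ι → ℕ) (hk : ∀ i ∈ s, 0 < k i) (f : ι → α → ℂ) (hf : ∀ i ∈ s, f i ∈ S) {F : α → ℂ}
    (hF : F ∈ S) (hFeq : F = ∑ i ∈ s, ((m i : ℂ) / k i) • f i) :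
    (ν F : ℂ) = ∑ i ∈ s, ((m i : ℂ) / k i) * ν (f i) := by
  have hdvd : ∀ i ∈ s, ((m i * ((∏ j ∈ s, k j) / k i) : ℕ) : ℂ) =
      (∏ j ∈ s, k j : ℕ) * ((m i : ℂ) / k i) := by
    intro i hi
    have : (k i : ℂ) ≠ 0 := by exact_mod_cast (hk i hi).ne'
    rw [Nat.cast_mul, Nat.cast_div (Finset.dvd_prod_of_mem k hi) this]
    ring
  have hN : ((∏ j ∈ s, k j : ℕ) : ℂ) ≠ 0 := by exact_mod_cast (Finset.prod_pos hk).ne'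
  have hmul : (∏ j ∈ s, k j) • F = ∑ i ∈ s, (m i * ((∏ j ∈ s, k j) / k i)) • f i := by
    rw [hFeq, Finset.smul_sum]
    refine Finset.sum_congr rfl fun i hi => ?_
    rw [← Nat.cast_smul_eq_nsmul ℂ, ← Nat.cast_smul_eq_nsmul ℂ, hdvd i hi, smul_smul]
  have h1 := map_sum_nsmul_of_additive_on S ν hν {()} (fun _ => ∏ j ∈ s, k j) (fun _ => F)
    (by simpa)
  have h2 := map_sum_nsmul_of_additive_on S ν hν s (fun i => m i * ((∏ j ∈ s, k j) / k i)) f hf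
  rw [Finset.sum_singleton, Finset.sum_singleton, hmul, h2] at h1
  refine mul_left_cancel₀ hN ?_
  rw [Finset.mul_sum]
  have h3 := congrArg (Int.cast : ℤ → ℂ) h1
  simp only [Int.cast_sum, Int.cast_mul, Int.cast_natCast] at h3
  rw [← h3]
  refine Finset.sum_congr rfl fun i hi => ?_
  rw [hdvd i hi, mul_assoc]

/-- Heilbronn–Stark Lemma: the restriction of Θ_G to H equals Θ_H. -/
theorem stmt9 {G : Type} [Group G] [Finite G]
    (𝒞 : ∀ H : Subgroup G, SCTheory H) (CG : SCTheory G)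
    (hfam : ∀ (H₁ H₂ : Subgroup G) (hle : H₁ ≤ H₂), CompatLE hle (𝒞 H₁) (𝒞 H₂))
    (hfamG : ∀ H : Subgroup G, Compat H (𝒞 H) CG)
    (n : ∀ H : Subgroup G, (H → ℂ) → ℤ) (nG : (G → ℂ) → ℤ)
    (ACH1G : ∀ f g : G → ℂ,
      f ∈ AddSubmonoid.closure ({σ | IsSC CG σ} ∪
        {f | ∃ (H : Subgroup G) (σ : H → ℂ), IsSC (𝒞 H) σ ∧ f = Sind H CG σ}) →
      g ∈ AddSubmonoid.closure ({σ | IsSC CG σ} ∪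
        {f | ∃ (H : Subgroup G) (σ : H → ℂ), IsSC (𝒞 H) σ ∧ f = Sind H CG σ}) →
      nG (f + g) = nG f + nG g)
    (ACH1 : ∀ (H : Subgroup G) (f g : H → ℂ),
      f ∈ AddSubmonoid.closure {σ | IsSC (𝒞 H) σ} →
      g ∈ AddSubmonoid.closure {σ | IsSC (𝒞 H) σ} →
      n H (f + g) = n H f + n H g)
    (ACH2 : ∀ (H : Subgroup G) (σ : H → ℂ), IsSC (𝒞 H) σ → nG (Sind H CG σ) = n H σ)
    (ACH3 : ∀ (H : Subgroup G) (σ : H → ℂ), IsSC (𝒞 H) σ → IsSumLin σ → 0 ≤ n H σ)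
    (H : Subgroup G) (h : H) :
    (∑ᶠ A ∈ CG.X, ((nG (sigma A) : ℂ) / sigma A 1) * sigma A (h : G)) =
      ∑ᶠ A ∈ (𝒞 H).X, ((n H (sigma A) : ℂ) / sigma A 1) * sigma A h := by
  have hres : ∀ A ∈ CG.X, IsSCF (𝒞 H) (fun x : H => sigma A (x : G)) := by
    intro A hA B hB x hx y hy
    rw [← (𝒞 H).sCl_eq hB hy] at hx
    exact SCTheory.eq_of_mem_sCl (CG.isSCF_sigma hA) (hfamG H y ⟨x, hx, rfl⟩)
  choose! d hd0 hd using fun A (hA : A ∈ CG.X) => CG.exists_sigma_one hA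
  choose! m hm using fun A (hA : A ∈ CG.X) B (hB : B ∈ (𝒞 H).X) =>
    iprod_sigma_comp_sigma (CG.partX.2.1 A hA) ((𝒞 H).partX.2.1 B hB)
  have hm' : ∀ A ∈ CG.X, ∀ B ∈ (𝒞 H).X,
      iprod H (fun x : H => sigma A (x : G)) (sigma B) = m A B := by
    intro A hA B hB
    rw [← iprod_conj, hm A hA B hB, Complex.conj_natCast]
  have hn : ∀ B ∈ (𝒞 H).X, (n H (sigma B) : ℂ) =
      ∑ A ∈ CG.finite_X.toFinset, ((m A B : ℂ) / d A) * nG (sigma A) := by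
    intro B hB
    rw [← ACH2 H (sigma B) ⟨B, hB, rfl⟩]
    refine map_rat_combination_of_additive_on _ nG ACH1G _ (fun A => m A B) d
      (fun A hA => hd0 A (by simpa using hA)) sigma
      (fun A hA => AddSubmonoid.subset_closure (Or.inl ⟨A, by simpa using hA, rfl⟩))
      (AddSubmonoid.subset_closure (Or.inr ⟨H, _, ⟨B, hB, rfl⟩, rfl⟩)) ?_
    refine (CG.eq_sum_sigma (CG.isSCF_sInd H (sigma B))).trans ?_
    refine Finset.sum_congr rfl fun A hA => ?_
    have hA : A ∈ CG.X := by simpa using hA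
    rw [CG.iprod_sInd H _ (CG.isSCF_sigma hA), hm A hA B hB, hd A hA]
  rw [finsum_mem_eq_finite_toFinset_sum _ CG.finite_X,
    finsum_mem_eq_finite_toFinset_sum _ (𝒞 H).finite_X]
  calc _ = ∑ A ∈ CG.finite_X.toFinset, ∑ B ∈ (𝒞 H).finite_X.toFinset,
      (nG (sigma A) : ℂ) / d A * (m A B / sigma B 1 * sigma B h) := by
        refine Finset.sum_congr rfl fun A hA => ?_
        have hA : A ∈ CG.X := by simpa using hA
        rw [← Finset.mul_sum, hd A hA]
        congr 1
        refine (congrFun ((𝒞 H).eq_sum_sigma (hres A hA)) h).trans ?_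
        rw [Finset.sum_apply]
        refine Finset.sum_congr rfl fun B hB => ?_
        rw [hm' A hA B (by simpa using hB), Pi.smul_apply, smul_eq_mul]
    _ = _ := by
        rw [Finset.sum_comm]
        refine Finset.sum_congr rfl fun B hB => ?_
        rw [hn B (by simpa using hB), Finset.sum_div, Finset.sum_mul]
        exact Finset.sum_congr rfl fun A _ => by ring
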